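/- Let K ≥ 1 be an integer coarsening factor, let Δ¹, Δ² : ℤ → ℝ be strictly positive fine-grid cell widths, and let u¹, u² : ℤ² → ℝ be fine-grid velocity fields. Define the fine-grid divergence (Du)(i,j) = (u¹(i,j) − u¹(i−1,j))/Δ¹(i) + (u²(i,j) − u²(i,j−1))/Δ²(j), the coarse widths Δ̄¹(a) = Σ_{m=0}^{K−1} Δ¹(K·a+m) and Δ̄²(b) = Σ_{m=0}^{K−1} Δ²(K·b+m), and the face-averaged coarse velocities ū¹(a,b) = Σ_{m=0}^{K−1} (Δ²(K·b+m)/Δ̄²(b))·u¹(K·a+K−1, K·b+m) and ū²(a,b) = Σ_{m=0}^{K−1} (Δ¹(K·a+m)/Δ̄¹(a))·u²(K·a+m, K·b+K−1). If (Du)(i,j) = 0 for all (i,j) ∈ ℤ², then for every (a,b) ∈ ℤ² the coarse-grid divergence vanishes: (ū¹(a,b) − ū¹(a−1,b))/Δ̄¹(a) + (ū²(a,b) − ū²(a,b−1))/Δ̄²(b) = 0. In other words, the face-averaging filter is divergence-consistent: it maps discretely divergence-free fine-grid velocity fields to discretely divergence-free coarse-grid velocity fields. -/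

import Mathlib

open Finset

/-- The telescoping sum over `K` consecutive integers starting at `s`. -/
lemma sum_range_backward_difference (g : ℤ → ℝ) (s : ℤ) (K : ℕ) :
    ∑ m ∈ range K, (g (s + m) - g (s + m - 1)) = g (s + K - 1) - g (s - 1) := by
  induction K with
  | zero => simp
  | succ k ih =>
    rw [sum_range_succ, ih]
    push_cast
    rw [← add_assoc, add_sub_cancel_right]
    ring

/-- The difference of the face averages on two opposite coarse faces is the normalized sum of all
fine-grid differences in between. -/
lemma faceAverage_sub_faceAverage (K : ℕ) (w : ℤ → ℝ) (W : ℝ) (f : ℤ → ℤ → ℝ) (a b : ℤ) :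
    ∑ n ∈ range K, w (K * b + n) / W * f (K * a + K - 1) (K * b + n) -
        ∑ n ∈ range K, w (K * b + n) / W * f (K * (a - 1) + K - 1) (K * b + n) =
      (∑ n ∈ range K, ∑ m ∈ range K,
        w (K * b + n) * (f (K * a + m) (K * b + n) - f (K * a + m - 1) (K * b + n))) / W := by
  rw [← sum_sub_distrib, sum_div]
  refine sum_congr rfl fun n _ ↦ ?_
  rw [← mul_sum, sum_range_backward_difference (fun i ↦ f i (K * b + n)),
    show (K : ℤ) * (a - 1) + K - 1 = K * a - 1 by ring]
  ring

/-- The face-averaging filter on a 2D staggered grid is divergence-consistent: it maps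
discretely divergence-free fine-grid velocity fields to discretely divergence-free
coarse-grid velocity fields. -/
theorem face_average_divergence_consistent_2D
    (K : ℕ) (hK : 1 ≤ K)
    (Δ1 Δ2 : ℤ → ℝ)
    (hΔ1 : ∀ i, 0 < Δ1 i) (hΔ2 : ∀ j, 0 < Δ2 j)
    (u1 u2 : ℤ → ℤ → ℝ)
    (Du : ℤ → ℤ → ℝ)
    (hDu : ∀ i j, Du i j =
      (u1 i j - u1 (i - 1) j) / Δ1 i + (u2 i j - u2 i (j - 1)) / Δ2 j)
    (Δb1 Δb2 : ℤ → ℝ)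
    (hΔb1 : ∀ a, Δb1 a = ∑ m ∈ range K, Δ1 ((K : ℤ) * a + (m : ℤ)))
    (hΔb2 : ∀ b, Δb2 b = ∑ m ∈ range K, Δ2 ((K : ℤ) * b + (m : ℤ)))
    (ub1 ub2 : ℤ → ℤ → ℝ)
    (hub1 : ∀ a b, ub1 a b =
      ∑ m ∈ range K, (Δ2 ((K : ℤ) * b + (m : ℤ)) / Δb2 b) *
        u1 ((K : ℤ) * a + (K : ℤ) - 1) ((K : ℤ) * b + (m : ℤ)))
    (hub2 : ∀ a b, ub2 a b =
      ∑ m ∈ range K, (Δ1 ((K : ℤ) * a + (m : ℤ)) / Δb1 a) *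
        u2 ((K : ℤ) * a + (m : ℤ)) ((K : ℤ) * b + (K : ℤ) - 1))
    (hdivfree : ∀ i j, Du i j = 0)
    (a b : ℤ) :
    (ub1 a b - ub1 (a - 1) b) / Δb1 a + (ub2 a b - ub2 a (b - 1)) / Δb2 b = 0 := by
  have flux_balance (i j : ℤ) :
      Δ2 j * (u1 i j - u1 (i - 1) j) + Δ1 i * (u2 i j - u2 i (j - 1)) = 0 := by
    have h := (hDu i j).symm.trans (hdivfree i j)
    have h1 := (hΔ1 i).ne'
    have h2 := (hΔ2 j).ne'
    field_simp at h
    linarith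
  rw [hub1, hub1, hub2, hub2, faceAverage_sub_faceAverage K Δ2 (Δb2 b) u1 a b,
    faceAverage_sub_faceAverage K Δ1 (Δb1 a) (fun j i ↦ u2 i j) b a, div_div, div_div,
    mul_comm (Δb2 b), ← add_div, sum_comm, ← sum_add_distrib]
  simp_rw [← sum_add_distrib, flux_balance]
  simp
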